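/- Let G = G(A) be the group generated by an invertible Mealy automaton A over the binary alphabet {0,1}. If G is abelian, then G is torsion-free or G is an elementary abelian 2-group. -/

import Mathlib

/-- The automorphism group of the rooted binary tree `{0,1}*`, realized as the subgroup of
permutations of `List Bool` (finite binary words, with `[]` the root and `w` adjacent to
`w ++ [x]`) consisting of those permutations that fix the root and map children of a vertex
to children of its image (equivalently, bijections fixing the root and preserving adjacency). -/
def binTreeAut : Subgroup (Equiv.Perm (List Bool)) where
  carrier := {f | f [] = [] ∧ ∀ (w : List Bool) (x : Bool), ∃ y : Bool, f (w ++ [x]) = f w ++ [y]}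
  one_mem' := ⟨rfl, fun w x => ⟨x, rfl⟩⟩
  mul_mem' := by
    rintro f g ⟨hf0, hf⟩ ⟨hg0, hg⟩
    refine ⟨by simp [Equiv.Perm.mul_apply, hg0, hf0], ?_⟩
    intro w x
    obtain ⟨y, hy⟩ := hg w x
    obtain ⟨z, hz⟩ := hf (g w) y
    exact ⟨z, by simp [Equiv.Perm.mul_apply, hy, hz]⟩
  inv_mem' := by
    rintro f ⟨hf0, hf⟩
    constructor
    · have h : f⁻¹ (f []) = [] := Equiv.symm_apply_apply f []
      rwa [hf0] at h
    · intro w x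
      have hfv : f (f⁻¹ (w ++ [x])) = w ++ [x] := Equiv.apply_symm_apply f (w ++ [x])
      rcases List.eq_nil_or_concat (f⁻¹ (w ++ [x])) with hnil | ⟨w', x', hcons⟩
      · rw [hnil, hf0] at hfv
        exact absurd hfv.symm (by simp)
      · rw [hcons, List.concat_eq_append] at hfv
        obtain ⟨y, hy⟩ := hf w' x'
        rw [hy] at hfv
        have h2 := List.append_inj' hfv rfl
        have hw' : w' = f⁻¹ w := by
          rw [← h2.1]; exact (Equiv.symm_apply_apply f w').symm
        refine ⟨x', ?_⟩
        rw [hcons, List.concat_eq_append, hw']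

/-- A time-varying automaton over the binary alphabet `{0,1}` (encoded as `Bool`) with state
set `Q`: a sequence of transition functions and a sequence of output functions.  (Indexing of
the transitions starts here at `0`, corresponding to the first transition.) -/
structure TVAutomaton (Q : Type*) where
  phi : ℕ → Q → Bool → Q
  psi : ℕ → Q → Bool → Bool

namespace TVAutomaton

variable {Q : Type*}

/-- An automaton is invertible if all labelings `x ↦ psi i q x` are bijections. -/
def Invertible (A : TVAutomaton Q) : Prop := ∀ i q, Function.Bijective (A.psi i q)

/-- A Mealy automaton is a time-varying automaton whose sequences of transition and output
functions are constant. -/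
def IsMealy (A : TVAutomaton Q) : Prop := ∀ i, A.phi i = A.phi 0 ∧ A.psi i = A.psi 0

/-- The automaton transformation of the state `q` in its `i`-th transition. -/
def act (A : TVAutomaton Q) : ℕ → Q → List Bool → List Bool
  | _, _, [] => []
  | i, q, x :: w => A.psi i q x :: A.act (i + 1) (A.phi i q x) w

/-- The inverse automaton transformation (for invertible automata). -/
noncomputable def invAct (A : TVAutomaton Q) : ℕ → Q → List Bool → List Bool
  | _, _, [] => []
  | i, q, y :: u =>
    Function.invFun (A.psi i q) y ::
      A.invAct (i + 1) (A.phi i q (Function.invFun (A.psi i q) y)) u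

theorem act_invAct (A : TVAutomaton Q) (h : A.Invertible) :
    ∀ (u : List Bool) (i : ℕ) (q : Q), A.act i q (A.invAct i q u) = u := by
  intro u
  induction u with
  | nil => intro i q; rfl
  | cons y u ih =>
    intro i q
    rw [invAct, act, ih]
    congr 1
    exact Function.rightInverse_invFun (h i q).2 y

theorem invAct_act (A : TVAutomaton Q) (h : A.Invertible) :
    ∀ (w : List Bool) (i : ℕ) (q : Q), A.invAct i q (A.act i q w) = w := by
  intro w
  induction w with
  | nil => intro i q; rfl
  | cons x w ih =>
    intro i q
    have hx : Function.invFun (A.psi i q) (A.psi i q x) = x :=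
      Function.leftInverse_invFun (h i q).1 x
    rw [act, invAct, hx, ih]

/-- The automaton transformation of the state `q` in its `i`-th transition, as a
permutation of the set of binary words. -/
noncomputable def toPerm (A : TVAutomaton Q) (h : A.Invertible) (i : ℕ) (q : Q) :
    Equiv.Perm (List Bool) where
  toFun := A.act i q
  invFun := A.invAct i q
  left_inv := fun w => A.invAct_act h w i q
  right_inv := fun u => A.act_invAct h u i q

theorem act_concat (A : TVAutomaton Q) :
    ∀ (w : List Bool) (i : ℕ) (q : Q) (x : Bool),
      ∃ y, A.act i q (w ++ [x]) = A.act i q w ++ [y] := by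
  intro w
  induction w with
  | nil => intro i q x; exact ⟨A.psi i q x, rfl⟩
  | cons a w ih =>
    intro i q x
    obtain ⟨y, hy⟩ := ih (i + 1) (A.phi i q a) x
    refine ⟨y, ?_⟩
    show A.psi i q a :: A.act (i + 1) (A.phi i q a) (w ++ [x]) = _
    rw [hy]; rfl

/-- The automaton transformation of the state `q` in its `i`-th transition, as an
automorphism of the rooted binary tree. -/
noncomputable def toAut (A : TVAutomaton Q) (h : A.Invertible) (i : ℕ) (q : Q) :
    ↥binTreeAut :=
  ⟨A.toPerm h i q, ⟨rfl, fun w x => A.act_concat w i q x⟩⟩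

/-- The group `G(A)` generated by an invertible time-varying automaton `A`: the subgroup of
`Aut({0,1}*)` generated by the transformations of all states of `A` in their first
transition. -/
noncomputable def genGroup (A : TVAutomaton Q) (h : A.Invertible) : Subgroup ↥binTreeAut :=
  Subgroup.closure (Set.range fun q => A.toAut h 0 q)

end TVAutomaton

/-- A tree automorphism belongs to the first level stabilizer: it fixes both one-letter
words. -/
def FixesLevelOne (g : ↥binTreeAut) : Prop :=
  (g : Equiv.Perm (List Bool)) [false] = [false] ∧ (g : Equiv.Perm (List Bool)) [true] = [true]

namespace TVAutomaton

variable {Q : Type*}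

theorem IsMealy.act_eq_act_zero {A : TVAutomaton Q} (hM : A.IsMealy) (w : List Bool) (i : ℕ)
    (q : Q) : A.act i q w = A.act 0 q w := by
  induction w generalizing i q with
  | nil => rfl
  | cons x w ih =>
    rw [act, act, (hM i).1, (hM i).2, ih (i + 1), ih (0 + 1)]

/-- The group generated by a Mealy automaton is self-similar: it contains all first-level
sections of its elements. -/
theorem IsMealy.exists_section {A : TVAutomaton Q} (hM : A.IsMealy) (h : A.Invertible)
    {g : ↥binTreeAut} (hg : g ∈ A.genGroup h) (x : Bool) :
    ∃ y : Bool, ∃ u ∈ A.genGroup h, ∀ w, g.1 (x :: w) = y :: u.1 w := by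
  induction hg using Subgroup.closure_induction generalizing x with
  | mem g hg =>
    obtain ⟨q, rfl⟩ := hg
    refine ⟨A.psi 0 q x, A.toAut h 0 (A.phi 0 q x), Subgroup.subset_closure ⟨_, rfl⟩, fun w => ?_⟩
    exact congrArg (A.psi 0 q x :: ·) (hM.act_eq_act_zero w 1 (A.phi 0 q x))
  | one => exact ⟨x, 1, one_mem _, fun _ => rfl⟩
  | mul a b _ _ iha ihb =>
    obtain ⟨y, u, hu, hb⟩ := ihb x
    obtain ⟨z, v, hv, ha⟩ := iha y
    exact ⟨z, v * u, mul_mem hv hu, fun w => by simp [hb, ha]⟩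
  | inv a _ iha =>
    obtain ⟨z, hz⟩ := (a⁻¹).2.2 [] x
    rw [(a⁻¹).2.1] at hz
    obtain ⟨y, u, hu, ha⟩ := iha z
    have hax : a.1 [z] = [x] := by
      have hz' : a.1⁻¹ [x] = [z] := hz
      rw [← hz']
      exact a.1.apply_symm_apply [x]
    obtain rfl : y = x := by
      have := ha []
      rw [hax, u.2.1] at this
      simpa using this.symm
    refine ⟨z, u⁻¹, inv_mem hu, fun w => ?_⟩
    change a.1⁻¹ (y :: w) = z :: u.1⁻¹ w
    rw [Equiv.Perm.inv_eq_iff_eq, ha]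
    exact congrArg (y :: ·) (u.1.apply_symm_apply w).symm

end TVAutomaton

theorem binTreeAut_apply_singleton (g : ↥binTreeAut) (x : Bool) : ∃ y : Bool, g.1 [x] = [y] := by
  obtain ⟨y, hy⟩ := g.2.2 [] x
  rw [g.2.1] at hy
  exact ⟨y, hy⟩

theorem fixesLevelOne_or_swap (g : ↥binTreeAut) :
    FixesLevelOne g ∨ (g.1 [false] = [true] ∧ g.1 [true] = [false]) := by
  obtain ⟨y, hy⟩ := binTreeAut_apply_singleton g false
  obtain ⟨z, hz⟩ := binTreeAut_apply_singleton g true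
  have hne : y ≠ z := by
    rintro rfl
    simpa using g.1.injective (hy.trans hz.symm)
  unfold FixesLevelOne
  rw [hy, hz]
  revert hne
  cases y <;> cases z <;> simp

theorem FixesLevelOne.apply_singleton {g : ↥binTreeAut} (hg : FixesLevelOne g) (x : Bool) :
    g.1 [x] = [x] := by
  cases x
  exacts [hg.1, hg.2]

theorem pow_apply_cons {g u : Equiv.Perm (List Bool)} {x : Bool}
    (hu : ∀ w, g (x :: w) = x :: u w) (n : ℕ) (w : List Bool) :
    (g ^ n) (x :: w) = x :: (u ^ n) w := by
  induction n with
  | zero => rfl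
  | succ n ih => rw [pow_succ', pow_succ', Equiv.Perm.mul_apply, ih, hu, Equiv.Perm.mul_apply]

namespace TVAutomaton

variable {Q : Type*}

theorem IsMealy.exists_section_of_fixesLevelOne {A : TVAutomaton Q} (hM : A.IsMealy)
    (h : A.Invertible) {g : ↥binTreeAut} (hg : g ∈ A.genGroup h) (hfix : FixesLevelOne g)
    (x : Bool) : ∃ u ∈ A.genGroup h, ∀ w, g.1 (x :: w) = x :: u.1 w := by
  obtain ⟨y, u, hu, hgu⟩ := hM.exists_section h hg x
  obtain rfl : x = y := by
    have := hgu []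
    rw [hfix.apply_singleton, u.2.1] at this
    simpa using this
  exact ⟨u, hu, hgu⟩

/-- A nontrivial element of exponent `n` has an iterated section of exponent `n` that swaps the
two vertices of the first level. -/
theorem IsMealy.exists_swap_of_pow_eq_one {A : TVAutomaton Q} (hM : A.IsMealy)
    (h : A.Invertible) {n : ℕ} {g : ↥binTreeAut} (hg : g ∈ A.genGroup h) (hn : g ^ n = 1)
    (hne : g ≠ 1) :
    ∃ t ∈ A.genGroup h, t ^ n = 1 ∧ t.1 [false] = [true] ∧ t.1 [true] = [false] := by
  obtain ⟨w, hw⟩ : ∃ w, g.1 w ≠ w := by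
    by_contra! hall
    exact hne (Subtype.ext (Equiv.ext hall))
  clear hne
  induction w generalizing g with
  | nil => exact absurd g.2.1 hw
  | cons x w ih =>
    rcases fixesLevelOne_or_swap g with hfix | hswap
    · obtain ⟨u, hu, hgu⟩ := hM.exists_section_of_fixesLevelOne h hg hfix x
      refine ih hu (Subtype.ext (Equiv.ext fun v => ?_)) fun huw => hw (by rw [hgu, huw])
      have hgn : g.1 ^ n = 1 := congrArg Subtype.val hn
      have := pow_apply_cons hgu n v
      rw [hgn] at this
      exact (List.cons.inj this).2.symm
    · exact ⟨g, hg, hn, hswap⟩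

/-- If an abelian Mealy group contains an involution swapping the first level, then it has
exponent two. -/
theorem IsMealy.sq_eq_one_of_swap {A : TVAutomaton Q} (hM : A.IsMealy) (h : A.Invertible)
    (hab : ∀ g ∈ A.genGroup h, ∀ g' ∈ A.genGroup h, g * g' = g' * g)
    {t : ↥binTreeAut} (ht : t ∈ A.genGroup h) (ht2 : t ^ 2 = 1)
    (hswap : t.1 [false] = [true] ∧ t.1 [true] = [false])
    {g : ↥binTreeAut} (hg : g ∈ A.genGroup h) : g ^ 2 = 1 := by
  refine Subtype.ext (Equiv.ext fun w => ?_)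
  change (g.1 ^ 2) w = w
  induction w generalizing g with
  | nil => exact (g ^ 2).2.1
  | cons x w ih =>
    obtain ⟨s, hs, hfix, hsq⟩ : ∃ s ∈ A.genGroup h, FixesLevelOne s ∧ s ^ 2 = g ^ 2 := by
      rcases fixesLevelOne_or_swap g with hfix | hg'
      · exact ⟨g, hg, hfix, rfl⟩
      · refine ⟨g * t, mul_mem hg ht, ⟨?_, ?_⟩, ?_⟩
        · simp [hg', hswap]
        · simp [hg', hswap]
        · rw [Commute.mul_pow (hab g hg t ht), ht2, mul_one]
    obtain ⟨u, hu, hsu⟩ := hM.exists_section_of_fixesLevelOne h hs hfix x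
    have hsq' : s.1 ^ 2 = g.1 ^ 2 := congrArg Subtype.val hsq
    rw [← hsq', pow_apply_cons hsu, ih hu]

end TVAutomaton

theorem even_of_pow_eq_one_of_swap {t : ↥binTreeAut} {n : ℕ} (hn : t ^ n = 1)
    (hswap : t.1 [false] = [true] ∧ t.1 [true] = [false]) : Even n := by
  have hpow : ∀ k : ℕ, ((t.1 ^ 2) ^ k) [true] = [true] := fun k =>
    Function.IsFixedPt.perm_pow (e := t.1 ^ 2)
      (by simp [Function.IsFixedPt, pow_two, hswap]) k
  by_contra hodd
  obtain ⟨k, rfl⟩ := Nat.not_even_iff_odd.mp hodd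
  have hn' : t.1 ^ (2 * k + 1) = 1 := congrArg Subtype.val hn
  rw [pow_succ, pow_mul] at hn'
  have happ := Equiv.congr_fun hn' [false]
  rw [Equiv.Perm.mul_apply, hswap.1, hpow] at happ
  simp at happ

/-- If the group `G = G(A)` generated by an invertible Mealy automaton over
the binary alphabet is abelian, then `G` is torsion-free or `G` is an elementary abelian
2-group. -/
theorem mealy_abelian_dichotomy (Q : Type) [Finite Q]
    (A : TVAutomaton Q) (h : A.Invertible) (hM : A.IsMealy)
    (hab : ∀ g ∈ A.genGroup h, ∀ g' ∈ A.genGroup h, g * g' = g' * g) :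
    (∀ g ∈ A.genGroup h, g ≠ 1 → ¬ IsOfFinOrder g) ∨ (∀ g ∈ A.genGroup h, g ^ 2 = 1) := by
  by_cases htor : ∃ g ∈ A.genGroup h, g ≠ 1 ∧ IsOfFinOrder g
  · right
    obtain ⟨g, hg, hne, hfin⟩ := htor
    obtain ⟨t, -, ht1, hswap⟩ := hM.exists_swap_of_pow_eq_one h hg (pow_orderOf_eq_one g) hne
    obtain ⟨m, hm⟩ := even_of_pow_eq_one_of_swap ht1 hswap
    have hpos : 0 < orderOf g := hfin.orderOf_pos
    obtain ⟨s, hs, hs2, hswap'⟩ := hM.exists_swap_of_pow_eq_one h (n := 2) (pow_mem hg m)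
      (by rw [← pow_mul, mul_two, ← hm, pow_orderOf_eq_one])
      (pow_ne_one_of_lt_orderOf (by lia) (by lia))
    exact fun a ha => hM.sq_eq_one_of_swap h hab hs hs2 hswap' ha
  · left
    exact fun g hg hne hfin => htor ⟨g, hg, hne, hfin⟩
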